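/- For each integer m ≥ 1 let T(β) be the m×m complex matrix with entries T_{kn}(β) = (e^β+1)/2 if k = n and T_{kn}(β) = (1−e^β)(1−(−1)^{n−k})/(2iπ(n−k)) if k ≠ n, and set Q(m,β) = det_m T(β) for m ≥ 1 and Q(0,β) = 1, regarded as a (smooth) function of the real variable β. Then for every integer m ≥ 1: 2·[∂²_β Q(m+1,β) − 2 ∂²_β Q(m,β) + ∂²_β Q(m−1,β)]|_{β=0} − 4·[∂_β Q(m+1,β) − ∂_β Q(m,β)]|_{β=0} + 1 = (2/(π² m²))·((−1)^m − 1). (This is the free-fermion value of the two-point function ⟨σ^z_1 σ^z_{m+1}⟩.) -/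

import Mathlib

open Complex Finset

/-- The matrix `T(β)` with entries `T_{kn} = (e^β+1)/2` on the diagonal and
`T_{kn} = (1−e^β)(1−(−1)^{n−k})/(2iπ(n−k))` off the diagonal, as a function of
the real variable `β`. -/
noncomputable def T (m : ℕ) (β : ℝ) : Matrix (Fin m) (Fin m) ℂ :=
  Matrix.of fun k n : Fin m =>
    if k = n then (Complex.exp (β : ℂ) + 1) / 2
    else (1 - Complex.exp (β : ℂ)) *
      (1 - (-1 : ℂ) ^ (((n : ℕ) : ℤ) - ((k : ℕ) : ℤ))) /
      (2 * Complex.I * (Real.pi : ℂ) * ((((n : ℕ) : ℤ) - ((k : ℕ) : ℤ) : ℤ) : ℂ))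

/-- The free-fermion generating function `Q(m,β) = det_m T(β)`; by convention
(determinant of the empty matrix) `Q(0,β) = 1`. -/
noncomputable def Q (m : ℕ) (β : ℝ) : ℂ := Matrix.det (T m β)

open Polynomial in
/-- The second-order coefficient of the polynomial `det (1 + X A)` is
`((tr A)² - tr A²) / 2`. -/
lemma exists_polynomial_det_one_add_smul {n : Type*} [Fintype n] [DecidableEq n]
    (A : Matrix n n ℂ) :
    ∃ f : ℂ[X], (∀ r : ℂ, (1 + r • A).det = 1 + A.trace * r + f.eval r * r ^ 2) ∧
      2 * f.eval 0 = A.trace ^ 2 - (A * A).trace := by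
  refine ⟨_, fun r => Matrix.det_one_add_smul r A, ?_⟩
  set f := (Matrix.det (1 + (X : ℂ[X]) • A.map C)).divX.divX
  set g := (Matrix.det (1 + (X : ℂ[X]) • (A * A).map C)).divX.divX
  have hA (r : ℂ) : (1 + r • A).det = 1 + A.trace * r + f.eval r * r ^ 2 :=
    Matrix.det_one_add_smul r A
  have hAA (r : ℂ) :
      (1 + r • (A * A)).det = 1 + (A * A).trace * r + g.eval r * r ^ 2 :=
    Matrix.det_one_add_smul r (A * A)
  have hmul (r : ℂ) : (1 + r • A).det * (1 + (-r) • A).det = (1 + (-r ^ 2) • (A * A)).det := by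
    rw [← Matrix.det_mul]
    congr 1
    simp only [add_mul, mul_add, one_mul, mul_one, smul_mul_smul_comm]
    module
  have hpoly : X ^ 2 * (f + f.comp (-X) - C (A.trace ^ 2) + C A.trace * X * f.comp (-X) -
      C A.trace * X * f + X ^ 2 * f * f.comp (-X)) =
      X ^ 2 * (-C (A * A).trace + X ^ 2 * g.comp (-X ^ 2)) := by
    refine Polynomial.funext fun r => ?_
    have h := hmul r
    rw [hA, hA, hAA] at h
    simp only [eval_mul, eval_add, eval_sub, eval_neg, eval_pow, eval_comp, eval_X, eval_C]
    linear_combination h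
  have h := congrArg (eval 0) (mul_left_cancel₀ (pow_ne_zero 2 X_ne_zero) hpoly)
  simp only [eval_mul, eval_add, eval_sub, eval_neg, eval_pow, eval_comp, eval_X, eval_C] at h
  norm_num at h
  linear_combination h

open Polynomial in
lemma hasDerivAt_eval_exp_sub_one (p : ℂ[X]) (β : ℝ) :
    HasDerivAt (fun b : ℝ => p.eval (Complex.exp (b : ℂ) - 1))
      (p.derivative.eval (Complex.exp (β : ℂ) - 1) * Complex.exp (β : ℂ)) β := by
  have h : HasDerivAt (fun b : ℂ => p.eval (Complex.exp b - 1))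
      (p.derivative.eval (Complex.exp (β : ℂ) - 1) * Complex.exp (β : ℂ)) (β : ℂ) :=
    (p.hasDerivAt _).comp (β : ℂ) ((Complex.hasDerivAt_exp (β : ℂ)).sub_const 1)
  exact h.comp_ofReal

/-- The symbol of the Toeplitz matrix `(T(β) - 1) / (e^β - 1)`. -/
noncomputable def freeFermionSymbol (d : ℤ) : ℂ :=
  if d = 0 then 1 / 2 else -((1 - (-1 : ℂ) ^ d) / (2 * Complex.I * (Real.pi : ℂ) * (d : ℂ)))

/-- The Toeplitz matrix `(T(β) - 1) / (e^β - 1)`. -/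
noncomputable def freeFermionMatrix (m : ℕ) : Matrix (Fin m) (Fin m) ℂ :=
  Matrix.of fun k n : Fin m => freeFermionSymbol (((n : ℕ) : ℤ) - ((k : ℕ) : ℤ))

lemma T_eq_one_add_smul (m : ℕ) (β : ℝ) :
    T m β = 1 + (Complex.exp (β : ℂ) - 1) • freeFermionMatrix m := by
  ext k n
  by_cases h : k = n
  · subst h
    simp only [T, freeFermionMatrix, freeFermionSymbol, Matrix.of_apply, Matrix.add_apply,
      Matrix.smul_apply, Matrix.one_apply_eq, sub_self, if_true, smul_eq_mul]
    ring
  · have h' : ((n : ℕ) : ℤ) - ((k : ℕ) : ℤ) ≠ 0 := by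
      have := Fin.val_ne_of_ne h
      omega
    simp only [T, freeFermionMatrix, freeFermionSymbol, Matrix.of_apply, Matrix.add_apply,
      Matrix.smul_apply, Matrix.one_apply_ne h, if_neg h, if_neg h', smul_eq_mul]
    ring

lemma trace_freeFermionMatrix (m : ℕ) : (freeFermionMatrix m).trace = m / 2 := by
  simp [Matrix.trace, freeFermionMatrix, freeFermionSymbol, div_eq_mul_inv]

lemma derivs_Q_zero (m : ℕ) :
    deriv (Q m) 0 = m / 2 ∧
      deriv (deriv (Q m)) 0 =
        (m / 2 : ℂ) ^ 2 - (freeFermionMatrix m * freeFermionMatrix m).trace + m / 2 := by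
  obtain ⟨f, hf, hf0⟩ := exists_polynomial_det_one_add_smul (freeFermionMatrix m)
  rw [trace_freeFermionMatrix] at hf hf0
  set p : Polynomial ℂ :=
    1 + Polynomial.C (m / 2 : ℂ) * Polynomial.X + f * Polynomial.X ^ 2 with hp
  have hQ : Q m = fun b : ℝ => p.eval (Complex.exp (b : ℂ) - 1) := by
    funext b
    rw [Q, T_eq_one_add_smul, hf]
    simp [hp]
  have hQ' : deriv (Q m) = fun b : ℝ =>
      p.derivative.eval (Complex.exp (b : ℂ) - 1) * Complex.exp (b : ℂ) := by
    rw [hQ]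
    exact funext fun b => (hasDerivAt_eval_exp_sub_one p b).deriv
  have hexp := (Complex.hasDerivAt_exp ((0 : ℝ) : ℂ)).comp_ofReal
  refine ⟨?_, ?_⟩
  · rw [hQ']
    simp [hp]
  · rw [hQ', ((hasDerivAt_eval_exp_sub_one p.derivative 0).fun_mul hexp).deriv, ← hf0]
    simp [hp]
    ring

/-- First difference in `m` of the double sum of a function of the difference of two indices. -/
lemma sum_range_succ_sub (h : ℤ → ℂ) (m : ℕ) :
    ∑ k ∈ Finset.range (m + 1), ∑ n ∈ Finset.range (m + 1), h ((n : ℤ) - k) =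
      ∑ k ∈ Finset.range m, ∑ n ∈ Finset.range m, h ((n : ℤ) - k) + h 0 +
        ∑ j ∈ Finset.range m, (h (j + 1) + h (-(j + 1))) := by
  simp only [Finset.sum_range_succ, Finset.sum_add_distrib, sub_self]
  have h₁ : ∑ k ∈ Finset.range m, h ((m : ℤ) - k) = ∑ j ∈ Finset.range m, h (j + 1) := by
    rw [← Finset.sum_range_reflect]
    refine Finset.sum_congr rfl fun j hj => congrArg h ?_
    have := Finset.mem_range.mp hj
    omega
  have h₂ : ∑ n ∈ Finset.range m, h ((n : ℤ) - m) = ∑ j ∈ Finset.range m, h (-(j + 1)) := by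
    rw [← Finset.sum_range_reflect]
    refine Finset.sum_congr rfl fun j hj => congrArg h ?_
    have := Finset.mem_range.mp hj
    omega
  rw [h₁, h₂]
  ring

lemma trace_freeFermionMatrix_mul_self (m : ℕ) :
    (freeFermionMatrix m * freeFermionMatrix m).trace =
      ∑ k ∈ Finset.range m, ∑ n ∈ Finset.range m,
        freeFermionSymbol ((n : ℤ) - k) * freeFermionSymbol (-((n : ℤ) - k)) := by
  simp [Matrix.trace, Matrix.mul_apply, freeFermionMatrix, Finset.sum_range]

lemma freeFermionSymbol_mul_neg {m : ℕ} (hm : m ≠ 0) :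
    freeFermionSymbol m * freeFermionSymbol (-m) =
      (1 - (-1 : ℂ) ^ m) / (2 * (Real.pi : ℂ) ^ 2 * (m : ℂ) ^ 2) := by
  have hm' : (m : ℂ) ≠ 0 := Nat.cast_ne_zero.mpr hm
  have hpi : (Real.pi : ℂ) ≠ 0 := Complex.ofReal_ne_zero.mpr Real.pi_ne_zero
  rcases neg_one_pow_eq_or ℂ m with h | h
  · simp [freeFermionSymbol, hm, h]
  · simp [freeFermionSymbol, hm, h]
    field_simp
    norm_num [Complex.I_sq]

/-- The free-fermion two-point function of third components of spin, obtained
from the generating function by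
`g_{zz}(m) = (2 D²_m ∂²_β − 4 D_m ∂_β + 1) Q(m,β)|_{β=0}`:
its value is `(2/(π²m²))((−1)^m − 1)`. -/
theorem free_fermion_gzz (m : ℕ) (hm : 1 ≤ m) :
    2 * (deriv (deriv (Q (m + 1))) 0 - 2 * deriv (deriv (Q m)) 0 +
          deriv (deriv (Q (m - 1))) 0) -
      4 * (deriv (Q (m + 1)) 0 - deriv (Q m) 0) + 1 =
    (2 / ((Real.pi : ℂ) ^ 2 * (m : ℂ) ^ 2)) * ((-1 : ℂ) ^ m - 1) := by
  obtain ⟨j, rfl⟩ := Nat.exists_eq_add_of_le' hm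
  have hs := freeFermionSymbol_mul_neg (m := j + 1) (Nat.succ_ne_zero j)
  have h₁ := sum_range_succ_sub (fun d => freeFermionSymbol d * freeFermionSymbol (-d)) (j + 1)
  have h₀ := sum_range_succ_sub (fun d => freeFermionSymbol d * freeFermionSymbol (-d)) j
  simp only [← trace_freeFermionMatrix_mul_self] at h₁ h₀
  rw [Finset.sum_range_succ] at h₁
  simp only [(derivs_Q_zero _).1, (derivs_Q_zero _).2, Nat.add_sub_cancel]
  push_cast at hs h₁ h₀ ⊢
  rw [neg_neg] at h₁
  have hpi : (Real.pi : ℂ) ≠ 0 := Complex.ofReal_ne_zero.mpr Real.pi_ne_zero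
  have hj : (j : ℂ) + 1 ≠ 0 := Nat.cast_add_one_ne_zero j
  have hval : (2 / ((Real.pi : ℂ) ^ 2 * ((j : ℂ) + 1) ^ 2)) * ((-1 : ℂ) ^ (j + 1) - 1) =
      -4 * ((1 - (-1 : ℂ) ^ (j + 1)) / (2 * (Real.pi : ℂ) ^ 2 * ((j : ℂ) + 1) ^ 2)) := by
    field_simp
    ring
  rw [hval]
  linear_combination -2 * h₁ + 2 * h₀ - 4 * hs
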